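/- For every nonnegative integer n, the number of partitions of 5n+4 is divisible by 5, i.e., p(5n+4) ≡ 0 (mod 5). -/

import Mathlib

open PowerSeries Finset

section FiniteJacobi

variable {A : Type*} [CommRing A]

/-- The finite Euler product `(1 - q) (1 - q ^ 2) ⋯ (1 - q ^ n)`. -/
def eulerProd (q : A) (n : ℕ) : A := ∏ i ∈ range n, (1 - q ^ (i + 1))

@[simp]
lemma eulerProd_zero (q : A) : eulerProd q 0 = 1 := by simp [eulerProd]

lemma eulerProd_succ (q : A) (n : ℕ) :
    eulerProd q (n + 1) = eulerProd q n * (1 - q ^ (n + 1)) := prod_range_succ _ _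

/-- The coefficient of `z ^ j`, for `j ≥ 0`, in the Laurent polynomial
`(1 - z⁻¹) ∏_{k = 1}^{n} (1 - z q ^ k) (1 - z⁻¹ q ^ k)`. -/
def tripleCoeff (q : A) : ℕ → ℕ → A
  | 0, 0 => 1
  | 0, _ + 1 => 0
  | n + 1, 0 => (1 + q ^ (2 * n + 2)) * tripleCoeff q n 0 -
      q ^ (n + 1) * (tripleCoeff q n 1 - tripleCoeff q n 0)
  | n + 1, j + 1 => (1 + q ^ (2 * n + 2)) * tripleCoeff q n (j + 1) -
      q ^ (n + 1) * (tripleCoeff q n j + tripleCoeff q n (j + 2))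

lemma tripleCoeff_eq_zero (q : A) {n j : ℕ} (h : n < j) : tripleCoeff q n j = 0 := by
  induction n generalizing j with
  | zero =>
    obtain ⟨j, rfl⟩ := Nat.exists_eq_add_one_of_ne_zero h.ne'
    rfl
  | succ n ih =>
    obtain ⟨j, rfl⟩ := Nat.exists_eq_add_one_of_ne_zero (Nat.ne_zero_of_lt h)
    rw [tripleCoeff, ih (by omega), ih (by omega), ih (by omega)]
    ring

lemma succ_succ_choose_two (j : ℕ) : (j + 2).choose 2 = (j + 1) + (j + 1).choose 2 := by
  rw [Nat.choose_succ_succ' (j + 1) 1, Nat.choose_one_right]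

lemma tripleCoeff_mul_eulerProd (q : A) (j m : ℕ) :
    tripleCoeff q (j + m) j * (eulerProd q m * eulerProd q (2 * j + m + 1)) =
      (-1) ^ j * q ^ (j + 1).choose 2 * eulerProd q (2 * (j + m) + 1) := by
  suffices H : ∀ n j m : ℕ, j + m = n →
      tripleCoeff q n j * (eulerProd q m * eulerProd q (2 * j + m + 1)) =
        (-1) ^ j * q ^ (j + 1).choose 2 * eulerProd q (2 * n + 1) from H _ j m rfl
  clear j m
  intro n
  induction n with
  | zero =>
    intro j m h
    obtain ⟨rfl, rfl⟩ : j = 0 ∧ m = 0 := by omega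
    simp [tripleCoeff]
  | succ n ih =>
    have same (j m : ℕ) (h : j + m = n) :
        tripleCoeff q n j * (eulerProd q (m + 1) * eulerProd q (2 * j + m + 2)) =
          (-1) ^ j * q ^ (j + 1).choose 2 * eulerProd q (2 * n + 1) *
            ((1 - q ^ (m + 1)) * (1 - q ^ (2 * j + m + 2))) := by
      rw [eulerProd_succ q m, eulerProd_succ q (2 * j + m + 1), ← ih j m h]
      ring
    have next (j m : ℕ) (h : j + m = n) :
        tripleCoeff q n (j + 1) * (eulerProd q (m + 1) * eulerProd q (2 * j + m + 2)) =
          (-1) ^ (j + 1) * q ^ (j + 2).choose 2 * eulerProd q (2 * n + 1) *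
            ((1 - q ^ (m + 1)) * (1 - q ^ m)) := by
      rcases m with _ | m
      · rw [tripleCoeff_eq_zero q (by omega)]
        simp
      · rw [eulerProd_succ q (m + 1), eulerProd_succ q m, ← ih (j + 1) m (by omega)]
        rw [show 2 * (j + 1) + m + 1 = 2 * j + (m + 1) + 2 by ring]
        ring
    have prev (j m : ℕ) (h : j + m = n) :
        tripleCoeff q n j * (eulerProd q m * eulerProd q (2 * j + m + 3)) =
          (-1) ^ j * q ^ (j + 1).choose 2 * eulerProd q (2 * n + 1) *
            ((1 - q ^ (2 * j + m + 2)) * (1 - q ^ (2 * j + m + 3))) := by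
      rw [eulerProd_succ q (2 * j + m + 2), eulerProd_succ q (2 * j + m + 1), ← ih j m h]
      ring
    have top : eulerProd q (2 * (n + 1) + 1) =
        eulerProd q (2 * n + 1) * (1 - q ^ (2 * n + 2)) * (1 - q ^ (2 * n + 3)) := by
      rw [show 2 * (n + 1) + 1 = 2 * n + 1 + 1 + 1 by ring, eulerProd_succ, eulerProd_succ]
    intro j m h
    rw [top]
    rcases j with _ | j
    · obtain rfl : m = n + 1 := by omega
      have h₀ := same 0 n (by omega)
      have h₁ := next 0 n (by omega)
      simp only [Nat.choose_succ_self, zero_add, mul_zero, pow_zero, mul_one, one_mul, pow_one,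
        Nat.choose_self] at h₀ h₁ ⊢
      rw [tripleCoeff]
      linear_combination (1 + q ^ (2 * n + 2) + q ^ (n + 1)) * h₀ - q ^ (n + 1) * h₁
    · have h₁ := prev j m (by omega)
      rw [tripleCoeff]
      rcases m with _ | m
      · obtain rfl : j = n := by omega
        rw [tripleCoeff_eq_zero q (Nat.lt_succ_self j),
          tripleCoeff_eq_zero q (show j < j + 2 by omega), succ_succ_choose_two,
          show 2 * (j + 1) + 0 + 1 = 2 * j + 0 + 3 by ring]
        linear_combination - q ^ (j + 1) * h₁
      · have h₀ := same (j + 1) m (by omega)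
        have h₂ := next (j + 1) m (by omega)
        rw [succ_succ_choose_two (j + 1)] at h₂
        rw [succ_succ_choose_two j] at h₀ h₂ ⊢
        obtain rfl : n = j + 1 + m := by omega
        rw [show 2 * (j + 1) + (m + 1) + 1 = 2 * j + (m + 1) + 3 by ring]
        rw [show 2 * (j + 1) + m + 2 = 2 * j + (m + 1) + 3 by ring] at h₀ h₂
        linear_combination (1 + q ^ (2 * (j + 1 + m) + 2)) * h₀ -
          q ^ (j + 1 + m + 1) * (h₁ + h₂)

lemma sum_tripleCoeff (q : A) {n N : ℕ} (h : n < N) :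
    ∑ j ∈ range N, (2 * j + 1) * tripleCoeff q n j = eulerProd q n ^ 2 := by
  induction n generalizing N with
  | zero =>
    obtain ⟨N, rfl⟩ := Nat.exists_eq_add_one_of_ne_zero h.ne'
    simp [sum_range_succ', tripleCoeff]
  | succ n ih =>
    obtain ⟨N, rfl⟩ := Nat.exists_eq_add_one_of_ne_zero (Nat.ne_zero_of_lt h)
    have h₀ := ih (N := N) (by omega)
    have h₁ := ih (N := N + 1) (by omega)
    have h₂ := ih (N := N + 2) (by omega)
    rw [sum_range_succ'] at h₁
    rw [sum_range_succ', sum_range_succ'] at h₂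
    rw [sum_range_succ']
    have shift : ∑ j ∈ range N, (2 * ((j + 1 : ℕ) : A) + 1) * tripleCoeff q (n + 1) (j + 1) =
        (1 + q ^ (2 * n + 2)) *
          ∑ j ∈ range N, (2 * ((j + 1 : ℕ) : A) + 1) * tripleCoeff q n (j + 1) -
        q ^ (n + 1) * (∑ j ∈ range N, (2 * (j : A) + 1) * tripleCoeff q n j +
          ∑ j ∈ range N, (2 * ((j + 1 + 1 : ℕ) : A) + 1) * tripleCoeff q n (j + 1 + 1) +
          2 * (∑ j ∈ range N, tripleCoeff q n j -
            ∑ j ∈ range N, tripleCoeff q n (j + 1 + 1))) := by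
      simp only [mul_sum, mul_add, ← sum_add_distrib, ← sum_sub_distrib]
      refine sum_congr rfl fun j _ ↦ ?_
      rw [tripleCoeff]
      push_cast
      ring
    have tele : ∑ j ∈ range N, tripleCoeff q n j - ∑ j ∈ range N, tripleCoeff q n (j + 1 + 1) =
        tripleCoeff q n 0 + tripleCoeff q n 1 := by
      have h₃ := (sum_range_succ (tripleCoeff q n) (N + 1)).symm.trans
        (sum_range_succ' (tripleCoeff q n) (N + 1))
      rw [sum_range_succ _ N, sum_range_succ' _ N, tripleCoeff_eq_zero q (j := N) (by omega),
        tripleCoeff_eq_zero q (j := N + 1) (by omega)] at h₃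
      linear_combination h₃
    rw [shift, tele, eulerProd_succ, tripleCoeff]
    push_cast at h₁ h₂ ⊢
    linear_combination (1 + q ^ (2 * n + 2)) * h₁ - q ^ (n + 1) * (h₀ + h₂)

end FiniteJacobi

section PowerSeries

variable (R : Type*) [CommRing R]

lemma isUnit_eulerProd_X (n : ℕ) : IsUnit (eulerProd (X : R⟦X⟧) n) := by
  rw [PowerSeries.isUnit_iff_constantCoeff]
  simp [eulerProd]

lemma X_pow_dvd_eulerProd_sub {n m : ℕ} (h : n ≤ m) :
    (X : R⟦X⟧) ^ (n + 1) ∣ eulerProd X m - eulerProd X n := by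
  induction m, h using Nat.le_induction with
  | base => simp
  | succ m hm ih =>
    rw [eulerProd_succ, show eulerProd (X : R⟦X⟧) m * (1 - X ^ (m + 1)) - eulerProd X n =
      (eulerProd X m - eulerProd X n) - eulerProd X m * X ^ (m + 1) by ring]
    exact ih.sub (Dvd.dvd.mul_left (pow_dvd_pow _ (by omega)) _)

lemma X_pow_dvd_pentagonalSeries_sub (n : ℕ) :
    (X : R⟦X⟧) ^ (n + 1) ∣ pentagonalSeries R - eulerProd X n := by
  rw [X_pow_dvd_iff]
  intro k hk
  obtain ⟨s, hs⟩ := Filter.eventually_atTop.1 (coeff_prod_one_sub_X_pow_eventually_eq R k)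
  obtain ⟨m, hm⟩ := s.exists_nat_subset_range
  have h₁ := hs (range (max m n)) (hm.trans (range_mono (le_max_left _ _)))
  have h₂ := X_pow_dvd_iff.1 (X_pow_dvd_eulerProd_sub R (le_max_right m n)) k hk
  rw [map_sub, sub_eq_zero] at h₂ ⊢
  rw [← h₁, ← h₂, eulerProd]

lemma X_pow_dvd_pentagonalSeries_mul_tripleCoeff_sub (j m : ℕ) :
    (X : R⟦X⟧) ^ (j + m + 1) ∣ pentagonalSeries R * tripleCoeff X (j + m) j -
      (-1) ^ j * X ^ (j + 1).choose 2 := by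
  have hj : j ≤ (j + 1).choose 2 := by
    rw [Nat.choose_succ_succ' j 1, Nat.choose_one_right]
    omega
  have hu := (isUnit_eulerProd_X R m).mul (isUnit_eulerProd_X R (2 * j + m + 1))
  rw [← hu.dvd_mul_right]
  have key : (pentagonalSeries R * tripleCoeff X (j + m) j - (-1) ^ j * X ^ (j + 1).choose 2) *
      (eulerProd X m * eulerProd X (2 * j + m + 1)) =
      X ^ (j + 1).choose 2 * ((-1) ^ j * ((pentagonalSeries R - eulerProd X m) *
        eulerProd X (2 * (j + m) + 1) +
        eulerProd X m * (eulerProd X (2 * (j + m) + 1) - eulerProd X (2 * j + m + 1)))) := by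
    linear_combination pentagonalSeries R * tripleCoeff_mul_eulerProd (X : R⟦X⟧) j m
  rw [key]
  refine (pow_dvd_pow X (show j + m + 1 ≤ (j + 1).choose 2 + (m + 1) by omega)).trans ?_
  rw [pow_add]
  refine mul_dvd_mul_left _ (Dvd.dvd.mul_left (dvd_add ?_ ?_) _)
  · exact (X_pow_dvd_pentagonalSeries_sub R m).mul_right _
  · exact Dvd.dvd.mul_left ((pow_dvd_pow X (by omega)).trans
      (X_pow_dvd_eulerProd_sub R (by omega))) _

/-- **Jacobi's identity** for the cube of the Euler product, modulo `X ^ (n + 1)`. -/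
lemma X_pow_dvd_pentagonalSeries_pow_three_sub (n : ℕ) :
    (X : R⟦X⟧) ^ (n + 1) ∣ pentagonalSeries R ^ 3 -
      ∑ j ∈ range (n + 1), (2 * (j : R⟦X⟧) + 1) * ((-1) ^ j * X ^ (j + 1).choose 2) := by
  have key : pentagonalSeries R ^ 3 -
      ∑ j ∈ range (n + 1), (2 * (j : R⟦X⟧) + 1) * ((-1) ^ j * X ^ (j + 1).choose 2) =
      (pentagonalSeries R - eulerProd X n) *
        ((pentagonalSeries R + eulerProd X n) * pentagonalSeries R) +
      ∑ j ∈ range (n + 1), (2 * (j : R⟦X⟧) + 1) *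
        (pentagonalSeries R * tripleCoeff X n j - (-1) ^ j * X ^ (j + 1).choose 2) := by
    have h := sum_tripleCoeff (X : R⟦X⟧) (Nat.lt_succ_self n)
    simp only [mul_sub, sum_sub_distrib, mul_left_comm _ (pentagonalSeries R), ← mul_sum, h]
    ring
  rw [key]
  refine dvd_add ((X_pow_dvd_pentagonalSeries_sub R n).mul_right _)
    (dvd_sum fun j hj ↦ Dvd.dvd.mul_left ?_ _)
  obtain ⟨m, rfl⟩ := Nat.exists_eq_add_of_le (Nat.lt_succ_iff.1 (mem_range.1 hj))
  exact X_pow_dvd_pentagonalSeries_mul_tripleCoeff_sub R j m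

variable {R}

lemma exists_of_coeff_pentagonalSeries_pow_three_ne_zero {n : ℕ}
    (h : coeff n (pentagonalSeries R ^ 3) ≠ 0) :
    ∃ j : ℕ, (j + 1).choose 2 = n ∧ (2 * j + 1 : R) ≠ 0 := by
  have h₁ := X_pow_dvd_iff.1 (X_pow_dvd_pentagonalSeries_pow_three_sub R n) n (Nat.lt_succ_self n)
  rw [map_sub, sub_eq_zero] at h₁
  rw [h₁, map_sum] at h
  obtain ⟨j, -, hj⟩ := exists_ne_zero_of_sum_ne_zero h
  have hC : (2 * (j : R⟦X⟧) + 1) * ((-1) ^ j * X ^ (j + 1).choose 2) =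
      C ((2 * (j : R) + 1) * (-1) ^ j) * X ^ (j + 1).choose 2 := by
    simp [mul_assoc, map_ofNat (C : R →+* R⟦X⟧) 2]
  rw [hC, coeff_C_mul, coeff_X_pow] at hj
  refine ⟨j, ?_, fun h0 ↦ hj (by simp [h0])⟩
  by_contra hne
  exact hj (by simp [Ne.symm hne])

variable (R) in
open scoped PowerSeries.WithPiTopology in
/-- The generating function of the partition numbers is the inverse of the Euler product. -/
lemma mk_card_partition_mul_pentagonalSeries :
    (PowerSeries.mk fun n ↦ (Fintype.card n.Partition : R)) * pentagonalSeries R = 1 := by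
  let : TopologicalSpace R := ⊥
  have : DiscreteTopology R := ⟨rfl⟩
  have h := (Nat.Partition.hasProd_powerSeriesMk_card_restricted R fun _ ↦ True).mul
    (WithPiTopology.hasProd_one_sub_X_pow R)
  have h_term (i : ℕ) : (∑' j : ℕ, (X : R⟦X⟧) ^ ((i + 1) * j)) * (1 - X ^ (i + 1)) = 1 := by
    simp_rw [pow_mul]
    exact WithPiTopology.tsum_pow_mul_one_sub_of_constantCoeff_eq_zero (by simp)
  simp only [if_true, h_term] at h
  simpa [Nat.Partition.restricted, Finset.card_univ] using h.unique hasProd_one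

end PowerSeries

lemma coeff_pentagonalSeries_pow_four_eq_zero (n : ℕ) :
    coeff (5 * n + 4) (pentagonalSeries (ZMod 5) ^ 4) = 0 := by
  rw [pow_succ', coeff_mul]
  refine sum_eq_zero fun ⟨a, b⟩ hab ↦ ?_
  rw [HasAntidiagonal.mem_antidiagonal] at hab
  by_contra hne
  obtain ⟨k, rfl⟩ : a ∈ Set.range pentagonal := by
    by_contra ha
    exact hne (by simp [coeff_pentagonalSeries_eq_zero _ ha])
  obtain ⟨j, rfl, hj⟩ :=
    exists_of_coeff_pentagonalSeries_pow_three_ne_zero (right_ne_zero_of_mul hne)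
  have hk := congrArg (Int.cast : ℤ → ZMod 5) (two_mul_natCast_pentagonal k)
  have ht : 2 * (j + 1).choose 2 = (j + 1) * j := by
    rw [Nat.choose_two_right, Nat.add_sub_cancel]
    exact Nat.mul_div_cancel' (by simpa [mul_comm] using (Nat.even_mul_succ_self j).two_dvd)
  have ht' := congrArg (Nat.cast : ℕ → ZMod 5) ht
  have hs := congrArg (Nat.cast : ℕ → ZMod 5) hab
  push_cast at hk ht' hs
  have h5 : (5 : ZMod 5) = 0 := rfl
  have key : (k : ZMod 5) * (3 * k - 1) + (j + 1) * j = 2 * 4 := by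
    linear_combination 2 * hs - hk - ht' + 2 * n * h5
  generalize (k : ZMod 5) = x at key
  generalize (j : ZMod 5) = y at key hj
  revert x y
  decide

lemma pow_eq_expand {p : ℕ} [hp : Fact p.Prime] (f : (ZMod p)⟦X⟧) :
    f ^ p = expand p hp.out.ne_zero f := by
  have h := MvPowerSeries.map_frobenius_expand p hp.out.ne_zero (R := ZMod p) (f := f)
  rw [ZMod.frobenius_zmod, MvPowerSeries.map_id] at h
  exact h.symm

/-- **Ramanujan's congruence modulo 5**: for every nonnegative integer `n`,
the number of partitions of `5 * n + 4` is divisible by `5`. -/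
theorem ramanujan_congruence_mod_five (n : ℕ) :
    5 ∣ Fintype.card (Nat.Partition (5 * n + 4)) := by
  have : Fact (Nat.Prime 5) := ⟨by norm_num⟩
  set P : (ZMod 5)⟦X⟧ := PowerSeries.mk fun n ↦ (Fintype.card n.Partition : ZMod 5) with hP
  have hPE : P * pentagonalSeries (ZMod 5) = 1 := mk_card_partition_mul_pentagonalSeries (ZMod 5)
  have hfactor : P = pentagonalSeries (ZMod 5) ^ 4 * expand 5 (by norm_num) P := by
    rw [← pow_eq_expand]
    have h4 : (P * pentagonalSeries (ZMod 5)) ^ 4 = 1 := by rw [hPE, one_pow]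
    linear_combination (-P) * h4
  have hcoeff : coeff (5 * n + 4) P = 0 := by
    rw [hfactor, coeff_mul]
    refine sum_eq_zero fun ⟨a, b⟩ hab ↦ ?_
    rw [HasAntidiagonal.mem_antidiagonal] at hab
    by_cases hb : 5 ∣ b
    · obtain ⟨c, rfl⟩ := hb
      obtain ⟨d, rfl⟩ : ∃ d, a = 5 * d + 4 := ⟨n - c, by omega⟩
      rw [coeff_pentagonalSeries_pow_four_eq_zero, zero_mul]
    · rw [coeff_expand_of_not_dvd _ _ _ hb, mul_zero]
  rw [hP, coeff_mk] at hcoeff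
  exact (ZMod.natCast_eq_zero_iff _ _).1 hcoeff
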